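/- (Achieveability.) Let d ≥ 2, let η be the uniform distribution on d outcomes, and let p, q ∈ ℝ^d be probability distributions with D(p‖η) > 0, D(q‖η) > 0, V(p‖η) > 0 and V(q‖η) > 0. Let (t_n) be a moderate sequence, set ε_n^− = e^{−n t_n²} and ε_n^+ = 1 − e^{−n t_n²}, define R_n^{th}(ε) = (1/n)·sup{ m ∈ ℕ : p^{⊗n} ⊗ η^{⊗m} ≻_ε q^{⊗m} ⊗ η^{⊗n} } (approximate majorisation with total variation error), and set ν = (V(p‖η)/D(p‖η)) / (V(q‖η)/D(q‖η)). Then, for both choices of sign, liminf_{n→∞} ( R_n^{th}(ε_n^±) − D(p‖η)/D(q‖η) ) / t_n ≥ ±(√(2 V(p‖η)) / D(q‖η)) · |1 ± 1/√ν|. -/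

import Mathlib

open Finset Filter Real Topology

noncomputable section

/-- A probability distribution on a finite type: nonnegative entries summing to 1. -/
def IsProbDist {α : Type*} [Fintype α] (a : α → ℝ) : Prop :=
  (∀ i, 0 ≤ a i) ∧ ∑ i, a i = 1

/-- A sharp distribution: a single entry equal to 1, all others 0. -/
def IsSharp {α : Type*} [Fintype α] (a : α → ℝ) : Prop :=
  ∃ i, a i = 1 ∧ ∀ j, j ≠ i → a j = 0

/-- The uniform distribution: all entries equal to `1 / |α|`. -/
def IsUniform {α : Type*} [Fintype α] (a : α → ℝ) : Prop :=
  ∀ i, a i = 1 / (Fintype.card α : ℝ)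

/-- Tensor (Kronecker) product of two vectors. -/
def tensor {α β : Type*} (a : α → ℝ) (b : β → ℝ) : α × β → ℝ :=
  fun x => a x.1 * b x.2

/-- `n`-fold tensor power of a vector. -/
def tpow {α : Type*} (a : α → ℝ) (n : ℕ) : (Fin n → α) → ℝ :=
  fun f => ∏ j, a (f j)

/-- Shannon entropy (natural logarithm, with the convention `0 · ln 0 = 0`). -/
def shannonH {α : Type*} [Fintype α] (a : α → ℝ) : ℝ :=
  -∑ i, a i * Real.log (a i)

/-- Entropy variance `V(a) = ∑ i, a i (ln a i + H(a))²`. -/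
def entV {α : Type*} [Fintype α] (a : α → ℝ) : ℝ :=
  ∑ i, a i * (Real.log (a i) + shannonH a) ^ 2

/-- Relative entropy `D(a‖b)`. -/
def relD {α : Type*} [Fintype α] (a b : α → ℝ) : ℝ :=
  ∑ i, a i * Real.log (a i / b i)

/-- Relative entropy variance `V(a‖b)`. -/
def relV {α : Type*} [Fintype α] (a b : α → ℝ) : ℝ :=
  ∑ i, a i * (Real.log (a i / b i) - relD a b) ^ 2

/-- Total variation distance. -/
def tvd {α : Type*} [Fintype α] (a b : α → ℝ) : ℝ :=
  (1 / 2) * ∑ i, |a i - b i|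

/-- Fidelity `F(a,b) = (∑ i √(a i · b i))²`. -/
def fid {α : Type*} [Fintype α] (a b : α → ℝ) : ℝ :=
  (∑ i, Real.sqrt (a i * b i)) ^ 2

/-- The entries of `a` sorted in non-increasing order, as a vector on `Fin (card α)`. -/
def descSorted {α : Type*} [Fintype α] (a : α → ℝ) : Fin (Fintype.card α) → ℝ :=
  fun i =>
    a ((Fintype.equivFin α).symm
      (Tuple.sort (fun j => -a ((Fintype.equivFin α).symm j)) i))

/-- `headSum a K = ∑_{1 ≤ i ≤ K} a^↓_i` (1-based indices `i`, comparison `(i : ℝ) ≤ K`,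
equivalently `i ≤ ⌊K⌋`). -/
def headSum {α : Type*} [Fintype α] (a : α → ℝ) (K : ℝ) : ℝ :=
  ∑ i ∈ Finset.univ.filter (fun i : Fin (Fintype.card α) => ((i : ℕ) + 1 : ℝ) ≤ K),
    descSorted a i

/-- `tailSum a K = ∑_{i ≥ K} a^↓_i` (1-based indices `i`, comparison `K ≤ (i : ℝ)`,
equivalently `i ≥ ⌈K⌉`). -/
def tailSum {α : Type*} [Fintype α] (a : α → ℝ) (K : ℝ) : ℝ :=
  ∑ i ∈ Finset.univ.filter (fun i : Fin (Fintype.card α) => K ≤ ((i : ℕ) + 1 : ℝ)),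
    descSorted a i

/-- `a` majorises `b` (written `a ≻ b`): every partial sum of the non-increasingly sorted
`a` dominates the corresponding partial sum of sorted `b` (shorter vectors padded with zeros). -/
def Maj {α β : Type*} [Fintype α] [Fintype β] (a : α → ℝ) (b : β → ℝ) : Prop :=
  ∀ j : ℕ, headSum b (j : ℝ) ≤ headSum a (j : ℝ)

/-- `a ≻_ε b`: approximate majorisation (from above) with total variation error:
there is a probability distribution `b̃` with `a ≻ b̃` and `δ(b, b̃) ≤ ε`. -/
def ApproxMajTV {α β : Type*} [Fintype α] [Fintype β] (a : α → ℝ) (b : β → ℝ) (ε : ℝ) : Prop :=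
  ∃ bt : β → ℝ, IsProbDist bt ∧ Maj a bt ∧ tvd b bt ≤ ε

/-- `a ≺_ε b`: approximate majorisation (from below) with total variation error:
there is a probability distribution `b̃` with `a ≺ b̃` and `δ(b, b̃) ≤ ε`. -/
def ApproxSubMajTV {α β : Type*} [Fintype α] [Fintype β] (a : α → ℝ) (b : β → ℝ) (ε : ℝ) : Prop :=
  ∃ bt : β → ℝ, IsProbDist bt ∧ Maj bt a ∧ tvd b bt ≤ ε

/-- A moderate sequence: `t n → 0` and `√n · t n → +∞`. -/
def ModerateSeq (t : ℕ → ℝ) : Prop :=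
  Tendsto t atTop (𝓝 0) ∧ Tendsto (fun n : ℕ => Real.sqrt (n : ℝ) * t n) atTop atTop

/-- The uniform distribution on `Fin d`. -/
def unif (d : ℕ) : Fin d → ℝ := fun _ => 1 / (d : ℝ)

/-- The embedding map `Γ` associated with `γ_i = c_i / N`: for each `i` it produces
`c_i` entries equal to `a_i / c_i`. -/
def embed {d : ℕ} (c : Fin d → ℕ) (a : Fin d → ℝ) : (Σ i : Fin d, Fin (c i)) → ℝ :=
  fun x => a x.1 / (c x.1 : ℝ)

/-- Cut-and-pile modification of the sorted version of `a`, with cut at `K`: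
the first entry absorbs the total mass of entries at (1-based) positions `≥ K`,
entries at positions `1 < i < K` are unchanged, and entries at positions `≥ K` are set to 0. -/
def cutAndPile {α : Type*} [Fintype α] (a : α → ℝ) (K : ℝ) : Fin (Fintype.card α) → ℝ :=
  fun i =>
    if (i : ℕ) = 0 then descSorted a i + tailSum a K
    else if ((i : ℕ) + 1 : ℝ) < K then descSorted a i else 0

/-- The total mass of `a` exceeding the level `c`. -/
def excess {α : Type*} [Fintype α] (a : α → ℝ) (c : ℝ) : ℝ :=
  ∑ i, max (a i - c) 0

section Majorisation

variable {α β : Type*} [Fintype α] [Fintype β]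

lemma descSorted_antitone (a : α → ℝ) : Antitone (descSorted a) := by
  intro i j hij
  have h := Tuple.monotone_sort (fun j => -a ((Fintype.equivFin α).symm j)) hij
  simp only [Function.comp_apply] at h
  unfold descSorted
  linarith

lemma sum_descSorted (a : α → ℝ) (g : ℝ → ℝ) :
    ∑ i, g (descSorted a i) = ∑ i, g (a i) :=
  Equiv.sum_comp ((Tuple.sort (fun j => -a ((Fintype.equivFin α).symm j))).trans
    (Fintype.equivFin α).symm) (fun i => g (a i))

lemma excess_eq_sum_descSorted (a : α → ℝ) (c : ℝ) :
    excess a c = ∑ i, max (descSorted a i - c) 0 :=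
  (sum_descSorted a (fun x => max (x - c) 0)).symm

lemma headSum_natCast (a : α → ℝ) (j : ℕ) :
    headSum a (j : ℝ) =
      ∑ i ∈ univ.filter (fun i : Fin (Fintype.card α) => (i : ℕ) < j), descSorted a i := by
  unfold headSum
  congr 1
  ext i
  simp only [mem_filter, mem_univ, true_and]
  exact_mod_cast Nat.succ_le_iff

lemma card_filter_lt_le (N j : ℕ) : #(univ.filter (fun i : Fin N => (i : ℕ) < j)) ≤ j := by
  rw [Fin.card_filter_val_lt]
  exact min_le_right _ _

lemma headSum_le_excess (a : α → ℝ) (j : ℕ) {c : ℝ} (hc : 0 ≤ c) :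
    headSum a (j : ℝ) ≤ excess a c + j * c := by
  rw [headSum_natCast, excess_eq_sum_descSorted]
  calc ∑ i ∈ univ.filter (fun i : Fin (Fintype.card α) => (i : ℕ) < j), descSorted a i
      ≤ ∑ i ∈ univ.filter (fun i : Fin (Fintype.card α) => (i : ℕ) < j),
          (max (descSorted a i - c) 0 + c) :=
        sum_le_sum fun i _ => by linarith [le_max_left (descSorted a i - c) 0]
    _ = ∑ i ∈ univ.filter (fun i : Fin (Fintype.card α) => (i : ℕ) < j),
          max (descSorted a i - c) 0
        + #(univ.filter (fun i : Fin (Fintype.card α) => (i : ℕ) < j)) * c := by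
        rw [sum_add_distrib, sum_const, nsmul_eq_mul]
    _ ≤ _ := by
        gcongr
        · exact subset_univ _
        · exact card_filter_lt_le _ _

/-- If `descSorted a` exceeds `c` exactly on the first `j` positions (up to ties),
the excess above `c` is read off from the `j`-th head sum. -/
lemma excess_eq_headSum_sub (a : α → ℝ) (j : ℕ) (hj : j ≤ Fintype.card α) (c : ℝ)
    (h₁ : ∀ i : Fin (Fintype.card α), (i : ℕ) < j → c ≤ descSorted a i)
    (h₂ : ∀ i : Fin (Fintype.card α), j ≤ (i : ℕ) → descSorted a i ≤ c) :
    excess a c = headSum a (j : ℝ) - j * c := by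
  rw [headSum_natCast, excess_eq_sum_descSorted]
  have hcard : (#(univ.filter (fun i : Fin (Fintype.card α) => (i : ℕ) < j)) : ℝ) = j := by
    rw [Fin.card_filter_val_lt, min_eq_right hj]
  rw [← hcard, ← nsmul_eq_mul, ← sum_const, ← sum_sub_distrib, sum_filter]
  refine sum_congr rfl fun i _ => ?_
  split_ifs with hi
  · exact max_eq_left (by linarith [h₁ i hi])
  · exact max_eq_right (by linarith [h₂ i (not_lt.1 hi)])

lemma descSorted_nonneg {a : α → ℝ} (ha : ∀ i, 0 ≤ a i) (i) : 0 ≤ descSorted a i := ha _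

lemma excess_zero {a : α → ℝ} (ha : IsProbDist a) : excess a 0 = 1 := by
  rw [← ha.2]
  exact sum_congr rfl fun i _ => by simp [ha.1 i]

lemma exists_headSum_eq {a : α → ℝ} (ha : IsProbDist a) (j : ℕ) :
    ∃ c, 0 ≤ c ∧ excess a c + j * c ≤ headSum a (j : ℝ) := by
  rcases Nat.eq_zero_or_pos j with rfl | hj
  · refine ⟨1, zero_le_one, ?_⟩
    rw [excess_eq_headSum_sub a 0 (Nat.zero_le _) 1 (fun i hi => absurd hi (Nat.not_lt_zero _))]
    · simp
    · intro i _
      unfold descSorted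
      rw [← ha.2]
      exact single_le_sum (fun i _ => ha.1 i) (mem_univ _)
  by_cases hjN : j ≤ Fintype.card α
  · have hlt : j - 1 < Fintype.card α := by omega
    refine ⟨descSorted a ⟨j - 1, hlt⟩, descSorted_nonneg ha.1 _, ?_⟩
    rw [excess_eq_headSum_sub a j hjN]
    · linarith
    · intro i hi
      exact descSorted_antitone a (show (i : ℕ) ≤ j - 1 by omega)
    · intro i hi
      exact descSorted_antitone a (show j - 1 ≤ (i : ℕ) by omega)
  · refine ⟨0, le_rfl, ?_⟩
    rw [excess_zero ha, headSum_natCast, filter_true_of_mem, sum_descSorted a (fun x => x), ha.2]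
    · simp
    · intro i _
      omega

lemma maj_of_excess_le {a : α → ℝ} {b : β → ℝ} (ha : IsProbDist a)
    (h : ∀ c, 0 ≤ c → excess b c ≤ excess a c) : Maj a b := by
  intro j
  obtain ⟨c, hc, hj⟩ := exists_headSum_eq ha j
  linarith [headSum_le_excess b j hc, h c hc]

lemma Maj.excess_le {a : α → ℝ} {b : β → ℝ} (h : Maj a b) {c : ℝ} (hc : 0 ≤ c) :
    excess b c ≤ excess a c := by
  set S := univ.filter (fun i => c < descSorted b i) with hS
  have hcard : #S ≤ Fintype.card β := (card_le_univ S).trans (by simp)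
  rw [excess_eq_headSum_sub b #S hcard c]
  · linarith [h #S, headSum_le_excess a #S hc]
  · intro i hi
    by_contra hlt
    push Not at hlt
    have : S ⊆ Iio i := by
      intro k hk
      rw [mem_Iio]
      by_contra hki
      push Not at hki
      have h1 := descSorted_antitone b hki
      have h2 := (mem_filter.1 hk).2
      linarith
    have := card_le_card this
    rw [Fin.card_Iio] at this
    omega
  · intro i hi
    by_contra hlt
    push Not at hlt
    have : Iic i ⊆ S := by
      intro k hk
      rw [mem_Iic] at hk
      exact mem_filter.2 ⟨mem_univ _, hlt.trans_le (descSorted_antitone b hk)⟩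
    have := card_le_card this
    rw [Fin.card_Iic] at this
    omega

lemma tvd_eq_sum_max {a b : α → ℝ} (h : ∑ i, a i = ∑ i, b i) :
    tvd a b = ∑ i, max (a i - b i) 0 := by
  have h1 : ∑ i, |a i - b i| = ∑ i, (2 * max (a i - b i) 0 - (a i - b i)) := by
    refine sum_congr rfl fun i _ => ?_
    rcases le_total (a i - b i) 0 with h | h
    · rw [abs_of_nonpos h, max_eq_right h]; ring
    · rw [abs_of_nonneg h, max_eq_left h]; ring
  unfold tvd
  rw [h1, sum_sub_distrib, sum_sub_distrib, h, ← mul_sum]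
  ring

lemma ApproxMajTV.excess_le {a : α → ℝ} {b : β → ℝ} {ε : ℝ} (hb : IsProbDist b)
    (h : ApproxMajTV a b ε) {c : ℝ} (hc : 0 ≤ c) : excess b c ≤ excess a c + ε := by
  obtain ⟨bt, hbt, hmaj, htv⟩ := h
  have h1 : excess b c ≤ excess bt c + tvd b bt := by
    rw [tvd_eq_sum_max (hb.2.trans hbt.2.symm)]
    unfold excess
    rw [← sum_add_distrib]
    refine sum_le_sum fun i _ => ?_
    refine max_le ?_ (by positivity)
    linarith [le_max_left (bt i - c) 0, le_max_left (b i - bt i) 0]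
  linarith [hmaj.excess_le hc]

lemma continuous_excess (a : α → ℝ) : Continuous (excess a) := by
  unfold excess
  fun_prop

lemma excess_anti (a : α → ℝ) : Antitone (excess a) := by
  intro c c' h
  exact sum_le_sum fun i _ => max_le_max (by linarith) le_rfl

lemma one_sub_le_excess {a : α → ℝ} (ha : IsProbDist a) (c : ℝ) :
    1 - Fintype.card α * c ≤ excess a c := by
  have : 1 - Fintype.card α * c = ∑ i, (a i - c) := by
    rw [sum_sub_distrib, ha.2, sum_const, nsmul_eq_mul, card_univ]
  rw [this]
  exact sum_le_sum fun i _ => le_max_left _ _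

lemma excess_nonneg (a : α → ℝ) (c : ℝ) : 0 ≤ excess a c :=
  sum_nonneg fun _ _ => le_max_right _ _

/-- The optimal smoothing of the target clips its entries between two levels. -/
theorem approxMajTV_of_excess_le {a : α → ℝ} {b : β → ℝ} {ε : ℝ}
    (ha : IsProbDist a) (hb : IsProbDist b) (hcard : Fintype.card α = Fintype.card β)
    (hε₀ : 0 ≤ ε) (hε₁ : ε ≤ 1)
    (h : ∀ c, 0 ≤ c → excess b c ≤ excess a c + ε) : ApproxMajTV a b ε := by
  have hne : Nonempty β := by
    by_contra hempty
    rw [not_nonempty_iff] at hempty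
    have := hb.2
    simp at this
  have hN : (0 : ℝ) < Fintype.card β := by exact_mod_cast Fintype.card_pos
  set N : ℝ := (Fintype.card β : ℝ) with hNdef
  have hb1 : ∀ i, b i ≤ 1 := fun i => by
    rw [← hb.2]
    exact single_le_sum (fun i _ => hb.1 i) (mem_univ _)
  have hex1 : excess b 1 = 0 := sum_eq_zero fun i _ => max_eq_right (by linarith [hb1 i])
  obtain ⟨hi, ⟨hhi0, -⟩, hhi⟩ : ε ∈ excess b '' Set.Icc 0 1 := by
    refine intermediate_value_Icc' zero_le_one (continuous_excess b).continuousOn ?_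
    rw [hex1, excess_zero hb]
    exact ⟨hε₀, hε₁⟩
  have hac : ∀ c, 1 - N * c ≤ excess a c := fun c => by
    have := one_sub_le_excess ha c
    rwa [hcard] at this
  by_cases hlarge : hi < 1 / N
  · refine ⟨fun _ => 1 / N, ⟨fun _ => by positivity, ?_⟩, ?_, ?_⟩
    · rw [sum_const, nsmul_eq_mul, card_univ, ← hNdef]
      field_simp
    · refine maj_of_excess_le ha fun c _ => ?_
      unfold excess
      rw [sum_const, nsmul_eq_mul, card_univ, ← hNdef]
      rcases le_total (1 / N - c) 0 with hc | hc
      · rw [max_eq_right hc, mul_zero]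
        exact excess_nonneg a c
      · rw [max_eq_left hc]
        have : N * (1 / N - c) = 1 - N * c := by field_simp
        rw [this]
        exact hac c
    · rw [tvd_eq_sum_max]
      · rw [← hhi]
        exact excess_anti b hlarge.le
      · rw [hb.2, sum_const, nsmul_eq_mul, card_univ, ← hNdef]
        field_simp
  · push Not at hlarge
    have hkc : Continuous fun l => ∑ i, max (l - b i) 0 := by fun_prop
    obtain ⟨lo, ⟨hlo0, hlohi⟩, hlo⟩ : ε ∈ (fun l => ∑ i, max (l - b i) 0) '' Set.Icc 0 hi := by
      refine intermediate_value_Icc hhi0 hkc.continuousOn ⟨?_, ?_⟩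
      · refine le_trans (le_of_eq (sum_eq_zero fun i _ => ?_)) hε₀
        exact max_eq_right (by linarith [hb.1 i])
      · have h1 : ∑ i, max (hi - b i) 0 = ∑ i, (max (b i - hi) 0 + hi - b i) := by
          refine sum_congr rfl fun i _ => ?_
          rcases le_total (b i) hi with h | h
          · rw [max_eq_left (by linarith), max_eq_right (by linarith)]; ring
          · rw [max_eq_right (by linarith), max_eq_left (by linarith)]; ring
        have h2 : ∑ i, max (hi - b i) 0 = ε + N * hi - 1 := by
          rw [h1, sum_sub_distrib, sum_add_distrib, hb.2, sum_const, nsmul_eq_mul, card_univ,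
            ← hNdef, ← hhi]
          rfl
        have h3 : 1 ≤ N * hi := by
          rw [div_le_iff₀ hN] at hlarge
          linarith
        change ε ≤ ∑ i, max (hi - b i) 0
        linarith
    have hlo' : ∑ i, max (lo - b i) 0 = ε := hlo
    have hform : ∀ i, max lo (min (b i) hi) = b i - max (b i - hi) 0 + max (lo - b i) 0 := by
      intro i
      rcases le_total (b i) hi with h1 | h1
      · rw [min_eq_left h1, max_eq_right (a := b i - hi) (by linarith)]
        rcases le_total lo (b i) with h2 | h2
        · rw [max_eq_right h2, max_eq_right (by linarith)]; ring
        · rw [max_eq_left h2, max_eq_left (by linarith)]; ring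
      · rw [min_eq_right h1, max_eq_left (a := b i - hi) (by linarith), max_eq_right hlohi,
          max_eq_right (by linarith)]
        ring
    have hsum : ∑ i, max lo (min (b i) hi) = 1 := by
      simp_rw [hform]
      rw [sum_add_distrib, sum_sub_distrib, hb.2, hlo', ← hhi]
      unfold excess
      ring
    refine ⟨fun i => max lo (min (b i) hi), ⟨fun i => le_max_of_le_left hlo0, hsum⟩, ?_, ?_⟩
    · refine maj_of_excess_le ha fun c hc => ?_
      rcases le_total c lo with hcl | hcl
      · have : excess (fun i => max lo (min (b i) hi)) c = 1 - N * c := by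
          rw [← hsum, hNdef, ← card_univ, ← nsmul_eq_mul, ← sum_const, ← sum_sub_distrib]
          exact sum_congr rfl fun i _ =>
            max_eq_left (by linarith [le_max_left lo (min (b i) hi)])
        rw [this]
        exact hac c
      rcases le_total c hi with hch | hch
      · have : excess (fun i => max lo (min (b i) hi)) c = excess b c - excess b hi := by
          unfold excess
          rw [← sum_sub_distrib]
          refine sum_congr rfl fun i _ => ?_
          simp only [max_def, min_def]
          split_ifs <;> linarith
        rw [this, hhi]
        linarith [h c hc]
      · refine le_trans (le_of_eq (sum_eq_zero fun i _ => ?_)) (excess_nonneg a c)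
        refine max_eq_right ?_
        have := max_le hlohi (min_le_right (b i) hi)
        linarith
    · rw [tvd_eq_sum_max (hb.2.trans hsum.symm), ← hhi]
      refine sum_le_sum fun i _ => max_le ?_ (le_max_right _ _)
      rw [hform]
      linarith [le_max_right (lo - b i) 0]

end Majorisation

section LargeDeviations

/-- The weight of `{y ≤ Y}`. -/
def upperTail {Ω : Type*} [Fintype Ω] (w Y : Ω → ℝ) (y : ℝ) : ℝ :=
  ∑ i ∈ univ.filter (fun i => y ≤ Y i), w i

/-- The weight of `{y < Y}`. -/
def strictTail {Ω : Type*} [Fintype Ω] (w Y : Ω → ℝ) (y : ℝ) : ℝ :=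
  ∑ i ∈ univ.filter (fun i => y < Y i), w i

/-- At speed `s`, the scaled logarithmic moment generating functions of `Y` converge to
that of a centred Gaussian of variance `W`. -/
def GaussianScaling {Ω : ℕ → Type*} [∀ n, Fintype (Ω n)] (w Y : ∀ n, Ω n → ℝ)
    (s : ℕ → ℝ) (W : ℝ) : Prop :=
  ∀ a δ : ℝ, 0 < δ → ∀ᶠ n in atTop,
    Real.exp (s n * (a ^ 2 * W / 2 - δ)) ≤ ∑ i, w n i * Real.exp (s n * (a * Y n i)) ∧
    ∑ i, w n i * Real.exp (s n * (a * Y n i)) ≤ Real.exp (s n * (a ^ 2 * W / 2 + δ))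

lemma upperTail_anti {Ω : Type*} [Fintype Ω] {w : Ω → ℝ} (hw : ∀ i, 0 ≤ w i) (Y : Ω → ℝ) :
    Antitone (upperTail w Y) := by
  intro y y' h
  refine sum_le_sum_of_subset_of_nonneg ?_ fun i _ _ => hw i
  exact monotone_filter_right _ fun i _ hi => h.trans hi

lemma strictTail_anti {Ω : Type*} [Fintype Ω] {w : Ω → ℝ} (hw : ∀ i, 0 ≤ w i) (Y : Ω → ℝ) :
    Antitone (strictTail w Y) := by
  intro y y' h
  refine sum_le_sum_of_subset_of_nonneg ?_ fun i _ _ => hw i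
  exact monotone_filter_right _ fun i _ hi => h.trans_lt hi

lemma strictTail_le_upperTail {Ω : Type*} [Fintype Ω] {w : Ω → ℝ} (hw : ∀ i, 0 ≤ w i)
    (Y : Ω → ℝ) (y : ℝ) : strictTail w Y y ≤ upperTail w Y y := by
  refine sum_le_sum_of_subset_of_nonneg ?_ fun i _ _ => hw i
  exact monotone_filter_right _ fun i _ hi => le_of_lt hi

lemma upperTail_add_strictTail_neg {Ω : Type*} [Fintype Ω] (w Y : Ω → ℝ) (y : ℝ) :
    upperTail w Y y + strictTail w (fun i => -Y i) (-y) = ∑ i, w i := by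
  rw [← sum_filter_add_sum_filter_not univ (fun i => y ≤ Y i)]
  simp [upperTail, strictTail]

lemma upperTail_le_one {Ω : Type*} [Fintype Ω] {w : Ω → ℝ} (hw : IsProbDist w)
    (Y : Ω → ℝ) (y : ℝ) : upperTail w Y y ≤ 1 := by
  rw [← hw.2]
  exact sum_le_sum_of_subset_of_nonneg (subset_univ _) fun i _ _ => hw.1 i

/-- Exponential Markov inequality. -/
lemma upperTail_le_exp {Ω : Type*} [Fintype Ω] {w : Ω → ℝ} (hw : ∀ i, 0 ≤ w i)
    (Y : Ω → ℝ) (y : ℝ) {θ : ℝ} (hθ : 0 ≤ θ) :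
    upperTail w Y y ≤ Real.exp (-(θ * y)) * ∑ i, w i * Real.exp (θ * Y i) := by
  rw [mul_sum]
  refine le_trans (sum_le_sum fun i hi => ?_)
    (sum_le_sum_of_subset_of_nonneg (filter_subset (fun i => y ≤ Y i) univ) fun i _ _ => ?_)
  · have h1 : y ≤ Y i := (mem_filter.1 hi).2
    have h2 : 1 ≤ Real.exp (-(θ * y)) * Real.exp (θ * Y i) := by
      rw [← Real.exp_add]
      exact Real.one_le_exp (by nlinarith)
    nlinarith [hw i]
  · have := hw i
    positivity

/-- Away from the window `(A - η) σ < Y ≤ (A + η) σ`, the tilt by `A` is dominated by the tilts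
by `A + η` and `A - η`. -/
lemma exp_moment_le_strictTail_add {Ω : Type*} [Fintype Ω] {w : Ω → ℝ} (hw : ∀ i, 0 ≤ w i)
    (Y : Ω → ℝ) {s σ A η : ℝ} (hs : 0 ≤ s) (hσ : 0 < σ) (hA : 0 ≤ A) (hη : 0 ≤ η) :
    ∑ i, w i * Real.exp (s * (A / σ * Y i)) ≤
      Real.exp (s * (A * (A + η))) * strictTail w Y ((A - η) * σ)
      + Real.exp (-(s * (η * (A + η)))) * (∑ i, w i * Real.exp (s * ((A + η) / σ * Y i)))
      + Real.exp (s * (η * (A - η))) * (∑ i, w i * Real.exp (s * ((A - η) / σ * Y i))) := by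
  unfold strictTail
  rw [sum_filter, mul_sum, mul_sum, mul_sum, ← sum_add_distrib, ← sum_add_distrib]
  refine sum_le_sum fun i _ => ?_
  have hwi := hw i
  obtain ⟨x, hx⟩ : ∃ x, x = Y i / σ := ⟨_, rfl⟩
  have hY : Y i = x * σ := by rw [hx]; field_simp
  have e0 : ∀ B : ℝ, B / σ * Y i = B * x := fun B => by rw [hx]; ring
  have hlt : (A - η) * σ < Y i ↔ A - η < x := by rw [hY]; exact mul_lt_mul_iff_left₀ hσ
  rw [e0, e0, e0]
  have e1 : Real.exp (-(s * (η * (A + η)))) * (w i * Real.exp (s * ((A + η) * x)))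
      = w i * Real.exp (s * (A * x) + s * (η * (x - (A + η)))) := by
    rw [mul_left_comm, ← Real.exp_add]
    congr 2
    ring
  have e2 : Real.exp (s * (η * (A - η))) * (w i * Real.exp (s * ((A - η) * x)))
      = w i * Real.exp (s * (A * x) + s * (η * ((A - η) - x))) := by
    rw [mul_left_comm, ← Real.exp_add]
    congr 2
    ring
  rw [e1, e2]
  have p1 : 0 ≤ w i * Real.exp (s * (A * x) + s * (η * (x - (A + η)))) :=
    mul_nonneg hwi (Real.exp_pos _).le
  have p2 : 0 ≤ w i * Real.exp (s * (A * x) + s * (η * ((A - η) - x))) :=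
    mul_nonneg hwi (Real.exp_pos _).le
  by_cases hlow : A - η < x
  · rw [if_pos (hlt.2 hlow)]
    have p0 : 0 ≤ Real.exp (s * (A * (A + η))) * w i := mul_nonneg (Real.exp_pos _).le hwi
    by_cases hup : x ≤ A + η
    · have : w i * Real.exp (s * (A * x)) ≤ Real.exp (s * (A * (A + η))) * w i := by
        rw [mul_comm]
        gcongr
      linarith
    · push Not at hup
      have : w i * Real.exp (s * (A * x)) ≤
          w i * Real.exp (s * (A * x) + s * (η * (x - (A + η)))) := by
        gcongr
        have : 0 ≤ s * (η * (x - (A + η))) := mul_nonneg hs (mul_nonneg hη (by linarith))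
        linarith
      linarith
  · rw [if_neg (fun h => hlow (hlt.1 h)), mul_zero]
    push Not at hlow
    have : w i * Real.exp (s * (A * x)) ≤
        w i * Real.exp (s * (A * x) + s * (η * ((A - η) - x))) := by
      gcongr
      have : 0 ≤ s * (η * ((A - η) - x)) := mul_nonneg hs (mul_nonneg hη (by linarith))
      linarith
    linarith

variable {Ω : ℕ → Type*} [∀ n, Fintype (Ω n)] {w Y : ∀ n, Ω n → ℝ} {s : ℕ → ℝ}

lemma GaussianScaling.neg {W : ℝ} (h : GaussianScaling w Y s W) :
    GaussianScaling w (fun n i => -Y n i) s W := by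
  intro a δ hδ
  simpa using h (-a) δ hδ

lemma GaussianScaling.upperTail_le {σ : ℝ} (h : GaussianScaling w Y s (σ ^ 2)) (hσ : 0 < σ)
    (hw : ∀ n i, 0 ≤ w n i) (hs : Tendsto s atTop atTop) {κ c : ℝ} (hκ : 0 ≤ κ)
    (hc : c < κ ^ 2 / 2) :
    ∀ᶠ n in atTop, upperTail (w n) (Y n) (κ * σ) ≤ Real.exp (-(c * s n)) := by
  filter_upwards [h (κ / σ) (κ ^ 2 / 2 - c) (by linarith), hs.eventually_ge_atTop 0]
    with n hn hsn
  have hθ : 0 ≤ s n * (κ / σ) := by positivity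
  refine (upperTail_le_exp (hw n) (Y n) (κ * σ) hθ).trans ?_
  simp_rw [mul_assoc (s n)]
  refine (mul_le_mul_of_nonneg_left hn.2 (Real.exp_pos _).le).trans (le_of_eq ?_)
  rw [← Real.exp_add]
  congr 1
  field_simp
  ring

lemma GaussianScaling.le_strictTail {σ : ℝ} (h : GaussianScaling w Y s (σ ^ 2)) (hσ : 0 < σ)
    (hw : ∀ n i, 0 ≤ w n i) (hs : Tendsto s atTop atTop) {κ c : ℝ} (hκ : 0 ≤ κ)
    (hc : κ ^ 2 / 2 < c) :
    ∀ᶠ n in atTop, Real.exp (-(c * s n)) ≤ strictTail (w n) (Y n) (κ * σ) := by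
  obtain ⟨η, hη0, hη⟩ : ∃ η : ℝ, 0 < η ∧
      (κ + η) ^ 2 / 2 + (κ + η) * η + η ^ 2 / 4 ≤ c := by
    refine ⟨min 1 ((c - κ ^ 2 / 2) / (2 * κ + 2)), ?_, ?_⟩
    · have : 0 < c - κ ^ 2 / 2 := by linarith
      positivity
    · set η := min 1 ((c - κ ^ 2 / 2) / (2 * κ + 2))
      have h0 : 0 < η := by
        have : 0 < c - κ ^ 2 / 2 := by linarith
        positivity
      have h1 : η ≤ 1 := min_le_left _ _
      have h2 : η * (2 * κ + 2) ≤ c - κ ^ 2 / 2 := by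
        rw [← le_div_iff₀ (by positivity)]
        exact min_le_right _ _
      nlinarith
  set A := κ + η with hA
  have hA0 : 0 < A := by positivity
  have hδ : 0 < η ^ 2 / 8 := by positivity
  have hlarge : ∀ᶠ n in atTop, 16 / η ^ 2 ≤ s n := hs.eventually_ge_atTop _
  filter_upwards [h (A / σ) _ hδ, h ((A + η) / σ) _ hδ, h ((A - η) / σ) _ hδ,
    hlarge, hs.eventually_ge_atTop 0] with n h0 hp hm hsn hs0
  set B := ∑ i, w n i * Real.exp (s n * (A / σ * Y n i))
  set S := strictTail (w n) (Y n) (κ * σ)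
  have key : B ≤ Real.exp (s n * (A * (A + η))) * S
      + Real.exp (-(s n * (η * (A + η)))) *
        (∑ i, w n i * Real.exp (s n * ((A + η) / σ * Y n i)))
      + Real.exp (s n * (η * (A - η))) *
        (∑ i, w n i * Real.exp (s n * ((A - η) / σ * Y n i))) := by
    have := exp_moment_le_strictTail_add (hw n) (Y n) hs0 hσ hA0.le hη0.le
    rwa [show (A - η) * σ = κ * σ by rw [hA]; ring] at this
  have up : Real.exp (-(s n * (η * (A + η)))) *
      (∑ i, w n i * Real.exp (s n * ((A + η) / σ * Y n i))) ≤
      Real.exp (s n * (A ^ 2 / 2 - 3 * η ^ 2 / 8)) := by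
    refine (mul_le_mul_of_nonneg_left hp.2 (Real.exp_pos _).le).trans (le_of_eq ?_)
    rw [← Real.exp_add]
    congr 1
    field_simp
    ring
  have dn : Real.exp (s n * (η * (A - η))) *
      (∑ i, w n i * Real.exp (s n * ((A - η) / σ * Y n i))) ≤
      Real.exp (s n * (A ^ 2 / 2 - 3 * η ^ 2 / 8)) := by
    refine (mul_le_mul_of_nonneg_left hm.2 (Real.exp_pos _).le).trans (le_of_eq ?_)
    rw [← Real.exp_add]
    congr 1
    field_simp
    ring
  have main : Real.exp (s n * (A ^ 2 / 2 - η ^ 2 / 8)) ≤ B := by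
    refine le_trans (le_of_eq ?_) h0.1
    congr 1
    field_simp
  have hu : Real.exp (-(s n * (η ^ 2 / 8))) ≤ 1 / 2 := by
    have h2 : 2 ≤ s n * (η ^ 2 / 8) := by
      rw [div_le_iff₀ (by positivity)] at hsn
      linarith
    rw [Real.exp_neg, inv_eq_one_div]
    gcongr
    linarith [Real.add_one_le_exp (s n * (η ^ 2 / 8))]
  set u := Real.exp (-(s n * (η ^ 2 / 8))) with hudef
  have hu0 : 0 < u := Real.exp_pos _
  set G := Real.exp (s n * (A ^ 2 / 2))
  have hG0 : 0 < G := Real.exp_pos _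
  have r1 : Real.exp (s n * (A ^ 2 / 2 - η ^ 2 / 8)) = G * u := by
    rw [← Real.exp_add]; congr 1; ring
  have r3 : Real.exp (s n * (A ^ 2 / 2 - 3 * η ^ 2 / 8)) = G * u ^ 3 := by
    rw [← Real.exp_nat_mul, ← Real.exp_add]; congr 1; push_cast; ring
  have r2 : Real.exp (s n * (A ^ 2 / 2 - η ^ 2 / 4)) = G * u ^ 2 := by
    rw [← Real.exp_nat_mul, ← Real.exp_add]; congr 1; push_cast; ring
  rw [r3] at up dn
  rw [r1] at main
  have hu3 : u ^ 2 + 2 * u ^ 3 ≤ u := by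
    have : 0 ≤ u * (1 - 2 * u) * (1 + u) :=
      mul_nonneg (mul_nonneg hu0.le (by linarith)) (by linarith)
    linarith
  have hwin : Real.exp (s n * (A ^ 2 / 2 - η ^ 2 / 4)) ≤ Real.exp (s n * (A * (A + η))) * S := by
    rw [r2]
    have := mul_le_mul_of_nonneg_left hu3 hG0.le
    linarith
  have hS : Real.exp (s n * (A ^ 2 / 2 - η ^ 2 / 4 - A * (A + η))) ≤ S := by
    rw [mul_sub, Real.exp_sub, div_le_iff₀ (Real.exp_pos _)]
    linarith
  refine le_trans (Real.exp_le_exp.2 ?_) hS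
  have := mul_le_mul_of_nonneg_left hη hs0
  linarith

end LargeDeviations

section TailComparison

variable {Ω₁ Ω₂ : ℕ → Type*} [∀ n, Fintype (Ω₁ n)] [∀ n, Fintype (Ω₂ n)]
  {w₁ Y₁ : ∀ n, Ω₁ n → ℝ} {w₂ Y₂ : ∀ n, Ω₂ n → ℝ} {s : ℕ → ℝ} {v u : ℝ}

lemma eventually_exp_neg_mul_le (hs : Tendsto s atTop atTop) {b c : ℝ} (hbc : b < c) (K : ℝ) :
    ∀ᶠ n in atTop, K * Real.exp (-(c * s n)) ≤ Real.exp (-(b * s n)) := by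
  filter_upwards [hs.eventually_ge_atTop (K / (c - b))] with n hn
  rw [div_le_iff₀ (by linarith)] at hn
  have h : Real.exp (-(b * s n)) = Real.exp (s n * (c - b)) * Real.exp (-(c * s n)) := by
    rw [← Real.exp_add]
    congr 1
    ring
  rw [h]
  gcongr
  linarith [Real.add_one_le_exp (s n * (c - b))]

lemma GaussianScaling.upperTail_le_strictTail_add
    (h₁ : GaussianScaling w₁ Y₁ s (v ^ 2)) (h₂ : GaussianScaling w₂ Y₂ s (u ^ 2))
    (hv : 0 < v) (hu : 0 < u) (hw₁ : ∀ n i, 0 ≤ w₁ n i) (hw₂ : ∀ n i, 0 ≤ w₂ n i)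
    (hs : Tendsto s atTop atTop) {D : ℝ} (hD : √2 * |v - u| < D) :
    ∀ᶠ n in atTop, ∀ z, -D / 2 ≤ z → upperTail (w₂ n) (Y₂ n) (z + D) ≤
      strictTail (w₁ n) (Y₁ n) z + 1 / 2 * Real.exp (-s n) := by
  have hD0 : 0 < D := lt_of_le_of_lt (by positivity) hD
  have h2 : (0 : ℝ) < √2 := by positivity
  have hsq : √2 ^ 2 = 2 := Real.sq_sqrt (by norm_num)
  have hstrict : ∀ n z, 0 ≤ strictTail (w₁ n) (Y₁ n) z := fun n z =>
    sum_nonneg fun i _ => hw₁ n i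
  have far : ∀ z₀, √2 * u < z₀ + D → ∃ z₁ < z₀, ∀ᶠ n in atTop, ∀ z, z₁ < z →
      upperTail (w₂ n) (Y₂ n) (z + D) ≤
        strictTail (w₁ n) (Y₁ n) z + 1 / 2 * Real.exp (-s n) := by
    intro z₀ hz₀
    obtain ⟨κ, hκ1, hκ2⟩ := exists_between ((lt_div_iff₀ hu).2 hz₀)
    rw [lt_div_iff₀ hu] at hκ2
    have hκ : 2 / 2 < κ ^ 2 / 2 := by nlinarith
    obtain ⟨c, hc1, hc2⟩ := exists_between hκ
    refine ⟨κ * u - D, by linarith, ?_⟩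
    filter_upwards [h₂.upperTail_le hu hw₂ hs (h2.le.trans hκ1.le) hc2,
      eventually_exp_neg_mul_le hs (b := 1) (c := c) (by linarith) 2] with n hn hn' z hz
    have := upperTail_anti (hw₂ n) (Y₂ n) (show κ * u ≤ z + D by linarith)
    rw [one_mul] at hn'
    linarith [hstrict n z]
  have near : ∀ z₀, -D / 2 ≤ z₀ → z₀ + D ≤ √2 * u → ∃ z₁ z₂, z₁ < z₀ ∧ z₀ < z₂ ∧
      ∀ᶠ n in atTop, ∀ z, z₁ < z → z < z₂ → upperTail (w₂ n) (Y₂ n) (z + D) ≤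
        strictTail (w₁ n) (Y₁ n) z + 1 / 2 * Real.exp (-s n) := by
    intro z₀ hz₀ hz₀'
    have hpos : 0 < (z₀ + D) / u := div_pos (by linarith) hu
    have hlt : z₀ / v < (z₀ + D) / u := by
      rw [div_lt_div_iff₀ hv hu]
      have hD1 : √2 * (u - v) < D :=
        lt_of_le_of_lt (mul_le_mul_of_nonneg_left (by rw [abs_sub_comm]; exact le_abs_self _)
          h2.le) hD
      rcases le_total u v with huv | huv
      · rcases le_total 0 z₀ with hz | hz
        · nlinarith
        · nlinarith
      · rcases le_total 0 z₀ with hz | hz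
        · have : z₀ ≤ √2 * v := by linarith
          have : z₀ * (u - v) ≤ √2 * v * (u - v) := by
            apply mul_le_mul_of_nonneg_right this; linarith
          nlinarith
        · nlinarith
    obtain ⟨κ₁, hκ1, hκ1'⟩ := exists_between (max_lt hpos hlt)
    obtain ⟨κ₂, hκ2, hκ2'⟩ := exists_between hκ1'
    have hκ10 : 0 < κ₁ := (le_max_left _ _).trans_lt hκ1
    have hκ11 : z₀ < κ₁ * v := (div_lt_iff₀ hv).1 ((le_max_right _ _).trans_lt hκ1)
    rw [lt_div_iff₀ hu] at hκ2'
    have hκ : κ₁ ^ 2 / 2 < κ₂ ^ 2 / 2 := by nlinarith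
    obtain ⟨c, hc1, hc2⟩ := exists_between hκ
    refine ⟨κ₂ * u - D, κ₁ * v, by linarith, hκ11, ?_⟩
    filter_upwards [h₂.upperTail_le hu hw₂ hs (hκ10.le.trans hκ2.le) hc2,
      h₁.le_strictTail hv hw₁ hs hκ10.le hc1] with n hn hn' z hz hz'
    have e1 := upperTail_anti (hw₂ n) (Y₂ n) (show κ₂ * u ≤ z + D by linarith)
    have e2 := strictTail_anti (hw₁ n) (Y₁ n) hz'.le
    linarith [Real.exp_pos (-s n)]
  have hcompact : ∀ᶠ n in atTop, ∀ z ∈ Set.Icc (-D / 2) (√2 * u + 1),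
      upperTail (w₂ n) (Y₂ n) (z + D) ≤
        strictTail (w₁ n) (Y₁ n) z + 1 / 2 * Real.exp (-s n) := by
    refine isCompact_Icc.induction_on
      (p := fun S => ∀ᶠ n in atTop, ∀ z ∈ S, upperTail (w₂ n) (Y₂ n) (z + D) ≤
        strictTail (w₁ n) (Y₁ n) z + 1 / 2 * Real.exp (-s n)) ?_ ?_ ?_ ?_
    · simp
    · intro S T hST hT
      filter_upwards [hT] with n hn z hz using hn z (hST hz)
    · intro S T hS hT
      filter_upwards [hS, hT] with n hn hn' z hz using hz.elim (hn z) (hn' z)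
    · intro z₀ hz₀
      by_cases hfar : √2 * u < z₀ + D
      · obtain ⟨z₁, hz₁, hev⟩ := far z₀ hfar
        exact ⟨Set.Ioi z₁, mem_nhdsWithin_of_mem_nhds (Ioi_mem_nhds hz₁), hev⟩
      · obtain ⟨z₁, z₂, hz₁, hz₂, hev⟩ := near z₀ hz₀.1 (not_lt.1 hfar)
        refine ⟨Set.Ioo z₁ z₂, mem_nhdsWithin_of_mem_nhds (Ioo_mem_nhds hz₁ hz₂), ?_⟩
        filter_upwards [hev] with n hn z hz using hn z hz.1 hz.2
  obtain ⟨z₁, hz₁, hev⟩ := far (√2 * u + 1) (by linarith)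
  filter_upwards [hcompact, hev] with n hn hn' z hz
  rcases le_total z (√2 * u + 1) with h | h
  · exact hn z ⟨hz, h⟩
  · exact hn' z (hz₁.trans_le h)

/-- Comparison of tails when the target is shifted down by more than the difference of the
critical deviations. -/
theorem GaussianScaling.upperTail_le_of_direct
    (h₁ : GaussianScaling w₁ Y₁ s (v ^ 2)) (h₂ : GaussianScaling w₂ Y₂ s (u ^ 2))
    (hv : 0 < v) (hu : 0 < u) (hw₁ : ∀ n, IsProbDist (w₁ n)) (hw₂ : ∀ n, IsProbDist (w₂ n))
    (hs : Tendsto s atTop atTop) {D : ℝ} (hD : √2 * |v - u| < D) :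
    ∀ᶠ n in atTop, ∀ z, upperTail (w₂ n) (Y₂ n) (z + D) ≤
      upperTail (w₁ n) (Y₁ n) z + 1 / 2 * Real.exp (-s n) := by
  filter_upwards [
    h₁.upperTail_le_strictTail_add h₂ hv hu (fun n => (hw₁ n).1) (fun n => (hw₂ n).1) hs hD,
    h₂.neg.upperTail_le_strictTail_add h₁.neg hu hv (fun n => (hw₂ n).1) (fun n => (hw₁ n).1) hs
      (by rwa [abs_sub_comm] at hD)] with n hn hn' z
  rcases le_total (-D / 2) z with hz | hz
  · exact (hn z hz).trans (add_le_add_left (strictTail_le_upperTail (hw₁ n).1 _ _) _)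
  · have e := hn' (-(z + D)) (by linarith)
    have e1 := upperTail_add_strictTail_neg (w₂ n) (Y₂ n) (z + D)
    have e2 := upperTail_add_strictTail_neg (w₁ n) (Y₁ n) z
    have e3 := strictTail_le_upperTail (hw₁ n).1 (fun i => -Y₁ n i) (-z)
    rw [(hw₂ n).2] at e1
    rw [(hw₁ n).2] at e2
    rw [show -(z + D) + D = -z by ring] at e
    linarith

/-- Comparison of tails when the target is shifted up by less than the sum of the critical
deviations. -/
theorem GaussianScaling.upperTail_le_of_converse
    (h₁ : GaussianScaling w₁ Y₁ s (v ^ 2)) (h₂ : GaussianScaling w₂ Y₂ s (u ^ 2))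
    (hv : 0 < v) (hu : 0 < u) (hw₁ : ∀ n, IsProbDist (w₁ n)) (hw₂ : ∀ n, IsProbDist (w₂ n))
    (hs : Tendsto s atTop atTop) {D : ℝ} (hD : D < √2 * (v + u)) :
    ∀ᶠ n in atTop, ∀ z, upperTail (w₂ n) (Y₂ n) (z - D) ≤
      upperTail (w₁ n) (Y₁ n) z + (1 - 2 * Real.exp (-s n)) := by
  have h2 : (0 : ℝ) < √2 := by positivity
  have hsq : √2 ^ 2 = 2 := Real.sq_sqrt (by norm_num)
  have key : ∀ x y, 0 < y → x < √2 * y → ∃ κ c, 0 ≤ κ ∧ κ ^ 2 / 2 < c ∧ c < 1 ∧ x ≤ κ * y := by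
    intro x y hy hxy
    obtain ⟨κ, hκ1, hκ2⟩ := exists_between (max_lt h2 ((div_lt_iff₀ hy).2 hxy))
    have hκ0 : 0 < κ := (le_max_left _ _).trans_lt hκ1
    have hκ : κ ^ 2 / 2 < 1 := by nlinarith
    obtain ⟨c, hc1, hc2⟩ := exists_between hκ
    exact ⟨κ, c, hκ0.le, hc1, hc2, ((div_lt_iff₀ hy).1 ((le_max_right _ _).trans_lt hκ1)).le⟩
  obtain ⟨J, hJ1, hJ2⟩ := exists_between (show D - √2 * u < √2 * v by linarith)
  obtain ⟨κ₁, c₁, hκ₁, hc₁, hc₁', hx₁⟩ := key J v hv hJ2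
  obtain ⟨κ₂, c₂, hκ₂, hc₂, hc₂', hx₂⟩ := key (D - J) u hu (by linarith)
  filter_upwards [h₁.le_strictTail hv (fun n => (hw₁ n).1) hs hκ₁ hc₁,
    h₂.neg.le_strictTail hu (fun n => (hw₂ n).1) hs hκ₂ hc₂,
    eventually_exp_neg_mul_le hs hc₁' 2, eventually_exp_neg_mul_le hs hc₂' 2]
    with n hn₁ hn₂ hs₁ hs₂ z
  rw [one_mul] at hs₁ hs₂
  rcases le_total z J with hz | hz
  · have e1 := upperTail_anti (hw₁ n).1 (Y₁ n) (hz.trans hx₁)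
    have e2 := strictTail_le_upperTail (hw₁ n).1 (Y₁ n) (κ₁ * v)
    linarith [upperTail_le_one (hw₂ n) (Y₂ n) (z - D)]
  · have e1 := upperTail_add_strictTail_neg (w₂ n) (Y₂ n) (z - D)
    rw [(hw₂ n).2] at e1
    have e2 := strictTail_anti (hw₂ n).1 (fun i => -Y₂ n i)
      (show -(z - D) ≤ κ₂ * u by linarith)
    have e3 : 0 ≤ upperTail (w₁ n) (Y₁ n) z := sum_nonneg fun i _ => (hw₁ n).1 i
    linarith

end TailComparison

section ProductDistributions

/-- Log-likelihood ratio of `a^{⊗k}` against the uniform distribution. -/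
def logRatio {d : ℕ} (a : Fin d → ℝ) (k : ℕ) (f : Fin k → Fin d) : ℝ :=
  ∑ j, Real.log (a (f j) / unif d (f j))

variable {d : ℕ} {a : Fin d → ℝ}

lemma IsProbDist.tpow {α : Type*} [Fintype α] {a : α → ℝ} (ha : IsProbDist a) (k : ℕ) :
    IsProbDist (tpow a k) := by
  refine ⟨fun f => prod_nonneg fun j _ => ha.1 _, ?_⟩
  unfold _root_.tpow
  rw [← Fintype.sum_pow, ha.2, one_pow]

lemma IsProbDist.tensor {α β : Type*} [Fintype α] [Fintype β] {a : α → ℝ} {b : β → ℝ}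
    (ha : IsProbDist a) (hb : IsProbDist b) : IsProbDist (tensor a b) := by
  refine ⟨fun x => mul_nonneg (ha.1 _) (hb.1 _), ?_⟩
  unfold _root_.tensor
  rw [Fintype.sum_prod_type, ← sum_mul_sum, ha.2, hb.2, one_mul]

lemma isProbDist_unif (hd : d ≠ 0) : IsProbDist (unif d) := by
  refine ⟨fun _ => by unfold unif; positivity, ?_⟩
  simp [unif, hd]

lemma tpow_unif (k : ℕ) (f : Fin k → Fin d) : tpow (unif d) k f = 1 / (d : ℝ) ^ k := by
  simp [tpow, unif]

lemma tpow_eq_exp_logRatio (ha : IsProbDist a) (hd : d ≠ 0) (k : ℕ) (f : Fin k → Fin d)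
    (hf : tpow a k f ≠ 0) : tpow a k f = Real.exp (logRatio a k f) / (d : ℝ) ^ k := by
  have hd' : (0 : ℝ) < d := by positivity
  unfold tpow at hf
  rw [prod_ne_zero_iff] at hf
  have hterm : ∀ j, Real.exp (Real.log (a (f j) / unif d (f j))) = a (f j) * d := by
    intro j
    have : 0 < a (f j) := lt_of_le_of_ne (ha.1 _) (Ne.symm (hf j (mem_univ _)))
    rw [Real.exp_log]
    · simp [unif]
    · unfold unif
      positivity
  unfold logRatio
  rw [Real.exp_sum]
  simp_rw [hterm]
  rw [prod_mul_distrib, prod_const, card_univ, Fintype.card_fin]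
  unfold tpow
  field_simp

lemma excess_tensor_unif (hd : d ≠ 0) (k l : ℕ) (c : ℝ) :
    excess (tensor (tpow a k) (tpow (unif d) l)) (c / (d : ℝ) ^ (k + l)) =
      ∑ f, max (tpow a k f - c / (d : ℝ) ^ k) 0 := by
  have hd' : (0 : ℝ) < d := by positivity
  unfold excess tensor
  rw [Fintype.sum_prod_type]
  refine sum_congr rfl fun f _ => ?_
  simp only [tpow_unif]
  rw [sum_const, nsmul_eq_mul, card_univ, Fintype.card_pi]
  simp only [Fintype.card_fin, prod_const, card_univ]
  push_cast
  rw [mul_max_of_nonneg _ _ (by positivity), mul_zero]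
  congr 1
  rw [pow_add]
  field_simp

lemma sum_max_le_upperTail (ha : IsProbDist a) (hd : d ≠ 0) (k : ℕ) (L : ℝ) :
    ∑ f, max (tpow a k f - Real.exp L / (d : ℝ) ^ k) 0 ≤
      upperTail (tpow a k) (logRatio a k) L := by
  have hd' : (0 : ℝ) < d := by positivity
  unfold upperTail
  rw [sum_filter]
  refine sum_le_sum fun f _ => ?_
  have hnn := (ha.tpow k).1 f
  split_ifs with h
  · refine max_le ?_ hnn
    have : 0 < Real.exp L / (d : ℝ) ^ k := by positivity
    linarith
  · push Not at h
    refine max_le ?_ le_rfl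
    by_cases hf : tpow a k f = 0
    · rw [hf]
      have : 0 < Real.exp L / (d : ℝ) ^ k := by positivity
      linarith
    · rw [tpow_eq_exp_logRatio ha hd k f hf, sub_nonpos]
      gcongr

lemma upperTail_le_sum_max (ha : IsProbDist a) (hd : d ≠ 0) (k : ℕ) (L r : ℝ) :
    upperTail (tpow a k) (logRatio a k) (L + r) ≤
      ∑ f, max (tpow a k f - Real.exp L / (d : ℝ) ^ k) 0 + Real.exp (-r) := by
  have hd' : (0 : ℝ) < d := by positivity
  have h1 : Real.exp (-r) = ∑ f, tpow a k f * Real.exp (-r) := by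
    rw [← sum_mul, (ha.tpow k).2, one_mul]
  unfold upperTail
  rw [sum_filter, h1, ← sum_add_distrib]
  refine sum_le_sum fun f _ => ?_
  have hnn := (ha.tpow k).1 f
  have hmax := le_max_right (tpow a k f - Real.exp L / (d : ℝ) ^ k) 0
  split_ifs with h
  · by_cases hf : tpow a k f = 0
    · rw [hf] at *
      simp
    · have h2 : Real.exp L / (d : ℝ) ^ k ≤ tpow a k f * Real.exp (-r) := by
        rw [tpow_eq_exp_logRatio ha hd k f hf, div_mul_eq_mul_div, ← Real.exp_add]
        gcongr
        linarith
      linarith [le_max_left (tpow a k f - Real.exp L / (d : ℝ) ^ k) 0]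
  · positivity

/-- Moment generating function of the centred single-letter log-likelihood ratio. -/
def centredMgf (a : Fin d → ℝ) (θ : ℝ) : ℝ :=
  ∑ i, a i * Real.exp (θ * (Real.log (a i / unif d i) - relD a (unif d)))

lemma sum_tpow_mul_exp (a : Fin d → ℝ) (k : ℕ) (θ : ℝ) :
    ∑ f, tpow a k f * Real.exp (θ * (logRatio a k f - k * relD a (unif d))) =
      centredMgf a θ ^ k := by
  unfold centredMgf
  rw [Fintype.sum_pow]
  refine sum_congr rfl fun f _ => ?_
  rw [prod_mul_distrib, ← Real.exp_sum, ← mul_sum, sum_sub_distrib, sum_const, card_univ,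
    Fintype.card_fin, nsmul_eq_mul]
  rfl

lemma abs_centredMgf_sub_le (ha : IsProbDist a) :
    ∃ C > 0, ∃ θ₀ > 0, ∀ θ, |θ| ≤ θ₀ →
      |centredMgf a θ - (1 + θ ^ 2 * relV a (unif d) / 2)| ≤ C * |θ| ^ 3 := by
  set z : Fin d → ℝ := fun i => Real.log (a i / unif d i) - relD a (unif d) with hz
  set K : ℝ := 1 + ∑ i, |z i| with hK
  have hK0 : 0 < K := by positivity
  have hzK : ∀ i, |z i| ≤ K := fun i => by
    have := single_le_sum (fun i _ => abs_nonneg (z i)) (mem_univ i)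
    linarith
  refine ⟨K ^ 3, by positivity, 1 / K, by positivity, fun θ hθ => ?_⟩
  have hmean : ∑ i, a i * z i = 0 := by
    simp only [hz, mul_sub, sum_sub_distrib]
    rw [← sum_mul, ha.2, one_mul]
    exact sub_self _
  have hexpand : centredMgf a θ - (1 + θ ^ 2 * relV a (unif d) / 2) =
      ∑ i, a i * (Real.exp (θ * z i) - (1 + θ * z i + (θ * z i) ^ 2 / 2)) := by
    have hV : relV a (unif d) = ∑ i, a i * z i ^ 2 := rfl
    have e : ∀ i, a i * (Real.exp (θ * z i) - (1 + θ * z i + (θ * z i) ^ 2 / 2)) =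
        a i * Real.exp (θ * z i) - (a i + θ * (a i * z i) + θ ^ 2 / 2 * (a i * z i ^ 2)) :=
      fun i => by ring
    simp_rw [e]
    rw [sum_sub_distrib, sum_add_distrib, sum_add_distrib, ← mul_sum, ← mul_sum, hmean, ha.2, hV]
    unfold centredMgf
    ring
  rw [hexpand]
  refine (abs_sum_le_sum_abs _ _).trans ?_
  have hbound : ∀ i, |a i * (Real.exp (θ * z i) - (1 + θ * z i + (θ * z i) ^ 2 / 2))| ≤
      a i * (K ^ 3 * |θ| ^ 3) := by
    intro i
    rw [abs_mul, abs_of_nonneg (ha.1 i)]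
    refine mul_le_mul_of_nonneg_left ?_ (ha.1 i)
    have hle : |θ * z i| ≤ |θ| * K := by
      rw [abs_mul]
      exact mul_le_mul_of_nonneg_left (hzK i) (abs_nonneg _)
    have h1 : |θ * z i| ≤ 1 := by
      refine hle.trans ?_
      rwa [le_div_iff₀ hK0] at hθ
    have h3 := Real.exp_bound h1 (n := 3) (by norm_num)
    simp only [sum_range_succ, range_zero, sum_empty, Nat.factorial] at h3
    norm_num at h3
    rw [← mul_pow, mul_comm K]
    have h4 : |θ * z i| ^ 3 ≤ (|θ| * K) ^ 3 := by gcongr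
    have h5 : 0 ≤ |θ * z i| ^ 3 := by positivity
    rw [abs_mul] at h4 h5
    exact h3.trans (by nlinarith)
  refine (sum_le_sum fun i _ => hbound i).trans ?_
  rw [← sum_mul, ha.2, one_mul]

/-- Quadratic behaviour of the logarithm of the moment generating function at the origin. -/
lemma exp_le_centredMgf_le (ha : IsProbDist a) {δ : ℝ} (hδ : 0 < δ) :
    ∃ θ₀ > 0, ∀ θ, |θ| ≤ θ₀ →
      Real.exp (θ ^ 2 * (relV a (unif d) / 2 - δ)) ≤ centredMgf a θ ∧
      centredMgf a θ ≤ Real.exp (θ ^ 2 * (relV a (unif d) / 2 + δ)) := by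
  obtain ⟨C, hC, θ₁, hθ₁, h⟩ := abs_centredMgf_sub_le ha
  set V := relV a (unif d) with hV
  have hV0 : 0 ≤ V := sum_nonneg fun i _ => mul_nonneg (ha.1 i) (sq_nonneg _)
  set W := V / 2 - δ with hW
  set θ₂ := min 1 (min θ₁ (min (δ / (2 * C)) (min (δ / (2 * (W ^ 2 + 1))) (1 / (|W| + 1)))))
    with hθ₂
  refine ⟨θ₂, by positivity, fun θ hθ => ?_⟩
  have b0 : |θ| ≤ 1 := hθ.trans (min_le_left _ _)
  have b1 : |θ| ≤ θ₁ := hθ.trans ((min_le_right _ _).trans (min_le_left _ _))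
  have b2 : |θ| ≤ δ / (2 * C) := hθ.trans ((min_le_right _ _).trans ((min_le_right _ _).trans
    (min_le_left _ _)))
  have b3 : |θ| ≤ δ / (2 * (W ^ 2 + 1)) := hθ.trans ((min_le_right _ _).trans
    ((min_le_right _ _).trans ((min_le_right _ _).trans (min_le_left _ _))))
  have b4 : |θ| ≤ 1 / (|W| + 1) := hθ.trans ((min_le_right _ _).trans
    ((min_le_right _ _).trans ((min_le_right _ _).trans (min_le_right _ _))))
  rw [le_div_iff₀ (by positivity)] at b2 b3 b4
  have hb := abs_le.1 (h θ b1)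
  have hsq : |θ| ^ 2 = θ ^ 2 := sq_abs θ
  have hcube : C * |θ| ^ 3 ≤ θ ^ 2 * (δ / 2) := by
    have : C * |θ| ^ 3 = θ ^ 2 * (|θ| * C) := by rw [← hsq]; ring
    rw [this]
    gcongr
    linarith
  have hθδ : 0 ≤ θ ^ 2 * δ := by positivity
  constructor
  · have hsmall : |θ ^ 2 * W| ≤ 1 := by
      rw [abs_mul, ← hsq, abs_of_nonneg (by positivity)]
      have : |θ| ^ 2 * |W| ≤ |θ| * (|W| + 1) := by
        have := mul_le_mul_of_nonneg_left b0 (abs_nonneg θ)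
        nlinarith [abs_nonneg W, abs_nonneg θ]
      linarith
    have hexp := (abs_le.1 (Real.abs_exp_sub_one_sub_id_le hsmall)).2
    have hq : (θ ^ 2 * W) ^ 2 ≤ θ ^ 2 * (δ / 2) := by
      have h1 : |θ| ^ 2 * W ^ 2 ≤ |θ| * (W ^ 2 + 1) := by
        have := mul_le_mul_of_nonneg_left b0 (abs_nonneg θ)
        nlinarith [sq_nonneg W, abs_nonneg θ]
      rw [hsq] at h1
      have : (θ ^ 2 * W) ^ 2 = θ ^ 2 * (θ ^ 2 * W ^ 2) := by ring
      rw [this]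
      gcongr
      linarith
    have : θ ^ 2 * W = θ ^ 2 * V / 2 - θ ^ 2 * δ := by rw [hW]; ring
    linarith [hb.1]
  · have := Real.add_one_le_exp (θ ^ 2 * (V / 2 + δ))
    linarith [hb.2]

end ProductDistributions

section Conversion

variable {d : ℕ} {a p q : Fin d → ℝ} {t : ℕ → ℝ}

lemma ModerateSeq.eventually_pos (ht : ModerateSeq t) : ∀ᶠ n in atTop, 0 < t n := by
  filter_upwards [ht.2.eventually_gt_atTop 0] with n hn
  exact pos_of_mul_pos_right hn (Real.sqrt_nonneg _)

lemma ModerateSeq.tendsto_mul_sq (ht : ModerateSeq t) :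
    Tendsto (fun n : ℕ => (n : ℝ) * t n ^ 2) atTop atTop := by
  refine (ht.2.atTop_mul_atTop₀ ht.2).congr fun n => ?_
  have := Real.mul_self_sqrt (Nat.cast_nonneg (α := ℝ) n)
  linear_combination t n ^ 2 * this

lemma ModerateSeq.tendsto_mul (ht : ModerateSeq t) :
    Tendsto (fun n : ℕ => (n : ℝ) * t n) atTop atTop := by
  have h : Tendsto (fun n : ℕ => √(n : ℝ)) atTop atTop :=
    Real.tendsto_sqrt_atTop.comp tendsto_natCast_atTop_atTop
  refine (h.atTop_mul_atTop₀ ht.2).congr fun n => ?_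
  rw [← mul_assoc, Real.mul_self_sqrt (Nat.cast_nonneg _)]

/-- Log-likelihood ratio of `a^{⊗k}`, centred and rescaled by `n t_n`. -/
def scaledLogRatio (a : Fin d → ℝ) (t : ℕ → ℝ) (n k : ℕ) (f : Fin k → Fin d) : ℝ :=
  (logRatio a k f - k * relD a (unif d)) / (n * t n)

lemma gaussianScaling_tpow (ha : IsProbDist a) (ht : ModerateSeq t) {k : ℕ → ℕ} {κ : ℝ}
    (hκ : 0 ≤ κ) (hk : Tendsto (fun n => (k n : ℝ) / n) atTop (𝓝 κ)) :
    GaussianScaling (fun n => tpow a (k n)) (fun n => scaledLogRatio a t n (k n))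
      (fun n => n * t n ^ 2) (κ * relV a (unif d)) := by
  intro b δ hδ
  set V := relV a (unif d)
  set δ' := δ / (2 * (κ * b ^ 2 + 1)) with hδ'
  have hδ'0 : 0 < δ' := by positivity
  have hδ'1 : κ * b ^ 2 * δ' < δ := by
    have h1 : (κ * b ^ 2 + 1) * δ' = δ / 2 := by rw [hδ']; field_simp
    have : 0 ≤ κ * b ^ 2 := by positivity
    nlinarith
  obtain ⟨θ₀, hθ₀, hmgf⟩ := exp_le_centredMgf_le ha hδ'0
  have hbt : Tendsto (fun n => |b * t n|) atTop (𝓝 0) := by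
    simpa using (ht.1.const_mul b).abs
  have hlo : Tendsto (fun n => (k n : ℝ) / n * (b ^ 2 * (V / 2 - δ'))) atTop
      (𝓝 (κ * (b ^ 2 * (V / 2 - δ')))) := hk.mul_const _
  have hup : Tendsto (fun n => (k n : ℝ) / n * (b ^ 2 * (V / 2 + δ'))) atTop
      (𝓝 (κ * (b ^ 2 * (V / 2 + δ')))) := hk.mul_const _
  filter_upwards [hbt.eventually (ge_mem_nhds hθ₀), ht.eventually_pos, eventually_gt_atTop 0,
    hlo.eventually_const_lt (show b ^ 2 * (κ * V) / 2 - δ < _ by linarith),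
    hup.eventually_lt_const (show _ < b ^ 2 * (κ * V) / 2 + δ by linarith)]
    with n hn htn hn0 hnlo hnup
  have hn0' : (0 : ℝ) < n := by exact_mod_cast hn0
  have hsum : ∑ f, tpow a (k n) f * Real.exp (n * t n ^ 2 * (b * scaledLogRatio a t n (k n) f)) =
      centredMgf a (b * t n) ^ k n := by
    rw [← sum_tpow_mul_exp]
    refine sum_congr rfl fun f _ => ?_
    unfold scaledLogRatio
    congr 2
    field_simp
  have hpow : ∀ x : ℝ, Real.exp ((b * t n) ^ 2 * x) ^ k n =
      Real.exp (n * t n ^ 2 * ((k n : ℝ) / n * (b ^ 2 * x))) := by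
    intro x
    rw [← Real.exp_nat_mul]
    congr 1
    field_simp
  have hs : 0 ≤ (n : ℝ) * t n ^ 2 := by positivity
  obtain ⟨h1, h2⟩ := hmgf _ hn
  rw [hsum]
  constructor
  · refine le_trans ?_ (pow_le_pow_left₀ (Real.exp_pos _).le h1 _)
    rw [hpow]
    exact Real.exp_le_exp.2 (mul_le_mul_of_nonneg_left hnlo.le hs)
  · refine le_trans (pow_le_pow_left₀ ((Real.exp_pos _).le.trans h1) h2 _) ?_
    rw [hpow]
    exact Real.exp_le_exp.2 (mul_le_mul_of_nonneg_left hnup.le hs)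

lemma upperTail_scaledLogRatio (w : (Fin k → Fin d) → ℝ) {n : ℕ} (h : 0 < (n : ℝ) * t n) (L : ℝ) :
    upperTail w (scaledLogRatio a t n k) ((L - k * relD a (unif d)) / (n * t n)) =
      upperTail w (logRatio a k) L := by
  unfold upperTail scaledLogRatio
  simp_rw [div_le_div_iff_of_pos_right h, sub_le_sub_iff_right]

lemma exp_neg_mul_le_of_moderate (ht : ModerateSeq t) {ρ : ℝ} (hρ : 0 < ρ) :
    ∀ᶠ n : ℕ in atTop, Real.exp (-(ρ * (n * t n))) ≤ 1 / 2 * Real.exp (-(n * t n ^ 2)) := by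
  filter_upwards [eventually_exp_neg_mul_le ht.tendsto_mul (half_lt_self hρ) 2,
    ht.1.eventually (gt_mem_nhds (half_pos hρ)), ht.eventually_pos] with n h1 h2 h3
  have : Real.exp (-(ρ / 2 * (n * t n))) ≤ Real.exp (-(n * t n ^ 2)) := by
    refine Real.exp_le_exp.2 (neg_le_neg ?_)
    have : (n : ℝ) * t n * t n ≤ n * t n * (ρ / 2) := by gcongr
    linarith
  linarith

/-- A comparison of rescaled tails implies convertibility. -/
lemma eventually_approxMajTV (hd : d ≠ 0) (hp : IsProbDist p) (hq : IsProbDist q)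
    (ht : ModerateSeq t) {k : ℕ → ℕ} {ε : ℕ → ℝ} {Δ ρ : ℝ} (hρ : 0 < ρ)
    (hε : ∀ n, 0 ≤ ε n ∧ ε n ≤ 1)
    (htail : ∀ᶠ n : ℕ in atTop, ∀ z,
      upperTail (tpow q (k n)) (scaledLogRatio q t n (k n)) (z - Δ) ≤
        upperTail (tpow p n) (scaledLogRatio p t n n) z
          + (ε n - 1 / 2 * Real.exp (-(n * t n ^ 2))))
    (hk : ∀ᶠ n : ℕ in atTop,
      (k n : ℝ) * relD q (unif d) ≤ n * relD p (unif d) + (Δ - ρ) * (n * t n)) :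
    ∀ᶠ n : ℕ in atTop, ApproxMajTV (tensor (tpow p n) (tpow (unif d) (k n)))
      (tensor (tpow q (k n)) (tpow (unif d) n)) (ε n) := by
  have hd' : (0 : ℝ) < d := by positivity
  filter_upwards [htail, hk, exp_neg_mul_le_of_moderate ht hρ, ht.tendsto_mul.eventually_gt_atTop 0]
    with n htail hk hexp hnt
  have hP := (hp.tpow n).tensor ((isProbDist_unif hd).tpow (k n))
  have hQ := (hq.tpow (k n)).tensor ((isProbDist_unif hd).tpow n)
  refine approxMajTV_of_excess_le hP hQ (by simp [mul_comm]) (hε n).1 (hε n).2 fun c hc => ?_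
  rcases hc.eq_or_lt with rfl | hc
  · rw [excess_zero hP, excess_zero hQ]
    linarith [(hε n).1]
  obtain ⟨L, hL⟩ : ∃ L, Real.exp L = c * (d : ℝ) ^ (n + k n) :=
    ⟨Real.log (c * (d : ℝ) ^ (n + k n)), Real.exp_log (by positivity)⟩
  have hcP : c = Real.exp L / (d : ℝ) ^ (n + k n) := by
    rw [hL]
    field_simp
  have e1 : excess (tensor (tpow p n) (tpow (unif d) (k n))) c =
      ∑ f, max (tpow p n f - Real.exp L / (d : ℝ) ^ n) 0 := by
    rw [hcP, excess_tensor_unif hd]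
  have e2 : excess (tensor (tpow q (k n)) (tpow (unif d) n)) c =
      ∑ f, max (tpow q (k n) f - Real.exp L / (d : ℝ) ^ k n) 0 := by
    rw [hcP, add_comm, excess_tensor_unif hd]
  rw [e1, e2]
  have h1 := sum_max_le_upperTail hq hd (k n) L
  have h2 := upperTail_le_sum_max hp hd n L (ρ * (n * t n))
  rw [← upperTail_scaledLogRatio _ hnt] at h1 h2
  have h3 := htail ((L + ρ * (n * t n) - n * relD p (unif d)) / (n * t n))
  have h4 := upperTail_anti (hq.tpow (k n)).1 (scaledLogRatio q t n (k n))
    (show (L + ρ * (n * t n) - n * relD p (unif d)) / (n * t n) - Δ ≤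
      (L - k n * relD q (unif d)) / (n * t n) by
      rw [div_sub' hnt.ne', div_le_div_iff_of_pos_right hnt]
      linarith)
  linarith

lemma upperTail_le_of_approxMajTV (hd : d ≠ 0) (hp : IsProbDist p) (hq : IsProbDist q) {n m : ℕ}
    {ε : ℝ} (h : ApproxMajTV (tensor (tpow p n) (tpow (unif d) m))
      (tensor (tpow q m) (tpow (unif d) n)) ε) (L r : ℝ) :
    upperTail (tpow q m) (logRatio q m) (L + r) ≤
      upperTail (tpow p n) (logRatio p n) L + ε + Real.exp (-r) := by
  have hd' : (0 : ℝ) < d := by positivity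
  have hQ := (hq.tpow m).tensor ((isProbDist_unif hd).tpow n)
  have h1 := h.excess_le hQ (c := Real.exp L / (d : ℝ) ^ (n + m)) (by positivity)
  rw [excess_tensor_unif hd, add_comm n m, excess_tensor_unif hd] at h1
  linarith [sum_max_le_upperTail hp hd n L, upperTail_le_sum_max hq hd m L r]

/-- A weak converse: the optimal rate deviates from its limit by at most `O(t_n)`. -/
lemma exists_rate_upper_bound (hd : d ≠ 0) (hp : IsProbDist p) (hq : IsProbDist q)
    (hDp : 0 < relD p (unif d)) (hDq : 0 < relD q (unif d)) (hVp : 0 < relV p (unif d))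
    (ht : ModerateSeq t) :
    ∃ C : ℝ, 0 ≤ C ∧ ∀ᶠ n : ℕ in atTop, ∀ (m : ℕ) (ε : ℝ), ε ≤ 1 - Real.exp (-(n * t n ^ 2)) →
      ApproxMajTV (tensor (tpow p n) (tpow (unif d) m)) (tensor (tpow q m) (tpow (unif d) n)) ε →
      (m : ℝ) ≤ n * (relD p (unif d) / relD q (unif d) + C * t n) := by
  set Dp := relD p (unif d) with hDp'
  set Dq := relD q (unif d) with hDq'
  set Vp := relV p (unif d)
  obtain ⟨θ₀, hθ₀, hmgf⟩ := exp_le_centredMgf_le hq one_pos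
  set K := relV q (unif d) / 2 + 1 with hK
  have hK0 : 0 < K := by
    have : 0 ≤ relV q (unif d) := sum_nonneg fun i _ => mul_nonneg (hq.1 i) (sq_nonneg _)
    positivity
  set A := 3 * √Vp with hA
  have hGE := gaussianScaling_tpow (k := fun n => n) (κ := 1) hp ht zero_le_one
    (tendsto_const_nhds.congr' (by
      filter_upwards [eventually_gt_atTop 0] with n hn
      have : (n : ℝ) ≠ 0 := by positivity
      field_simp))
  rw [one_mul, show relV p (unif d) = √Vp ^ 2 from (Real.sq_sqrt hVp.le).symm] at hGE
  have hPtail := hGE.upperTail_le (Real.sqrt_pos.2 hVp) (fun n => (hp.tpow n).1)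
    ht.tendsto_mul_sq (κ := 3) (c := 2) (by norm_num) (by norm_num)
  refine ⟨2 * (A + 3 + Dp / Dq * K) / Dq, by positivity, ?_⟩
  set C := 2 * (A + 3 + Dp / Dq * K) / Dq with hC
  have hCD : C * Dq = 2 * (A + 3 + Dp / Dq * K) := by rw [hC]; field_simp
  have hA0 : 0 ≤ A := by positivity
  have hC0 : 0 ≤ C := by positivity
  filter_upwards [hPtail, exp_neg_mul_le_of_moderate ht one_pos,
    ht.1.eventually (ge_mem_nhds hθ₀),
    ht.1.eventually (gt_mem_nhds (show 0 < Dq / (2 * K) by positivity)),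
    ht.eventually_pos, ht.tendsto_mul.eventually_gt_atTop 0,
    eventually_exp_neg_mul_le ht.tendsto_mul_sq (one_lt_two) 5]
    with n hP hexp hθ hsmall htn hnt hbig m ε hε hmaj
  by_contra hcon
  push Not at hcon
  have hmain := upperTail_le_of_approxMajTV hd hp hq hmaj (n * Dp + A * (n * t n)) (1 * (n * t n))
  have hP' : upperTail (tpow p n) (logRatio p n) (n * Dp + A * (n * t n)) ≤
      Real.exp (-(2 * (n * t n ^ 2))) := by
    rw [← upperTail_scaledLogRatio _ hnt]
    convert hP using 2
    rw [← hDp', add_sub_cancel_left]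
    exact mul_div_cancel_right₀ _ hnt.ne'
  set L := n * Dp + A * (n * t n) + 1 * (n * t n) with hL
  have hQ' : strictTail (tpow q m) (fun f => -logRatio q m f) (-L) ≤
      Real.exp (-(2 * (n * t n ^ 2))) := by
    refine (strictTail_le_upperTail (hq.tpow m).1 _ _).trans ?_
    refine (upperTail_le_exp (hq.tpow m).1 _ (-L) htn.le).trans ?_
    have hsum : ∑ f, tpow q m f * Real.exp (t n * -logRatio q m f) =
        Real.exp (-(t n * (m * Dq))) * centredMgf q (-t n) ^ m := by
      rw [← sum_tpow_mul_exp, mul_sum]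
      refine sum_congr rfl fun f _ => ?_
      rw [mul_left_comm, ← Real.exp_add]
      congr 2
      rw [← hDq']
      ring
    have hM := hmgf (-t n) (by rwa [abs_neg, abs_of_pos htn])
    have hMm : centredMgf q (-t n) ^ m ≤ Real.exp (m * (t n ^ 2 * K)) := by
      rw [Real.exp_nat_mul]
      refine pow_le_pow_left₀ ((Real.exp_pos _).le.trans hM.1) ?_ m
      simpa using hM.2
    rw [hsum]
    calc Real.exp (-(t n * -L)) * (Real.exp (-(t n * (m * Dq))) * centredMgf q (-t n) ^ m)
        ≤ Real.exp (-(t n * -L)) * (Real.exp (-(t n * (m * Dq))) *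
            Real.exp (m * (t n ^ 2 * K))) := by gcongr
      _ = Real.exp (t n * (L - m * (Dq - K * t n))) := by
          rw [← Real.exp_add, ← Real.exp_add]
          congr 1
          ring
      _ ≤ _ := by
          refine Real.exp_le_exp.2 ?_
          have h1 : Dq / 2 ≤ Dq - K * t n := by
            rw [lt_div_iff₀ (by positivity)] at hsmall
            linarith
          have h2 : (n : ℝ) * (Dp / Dq + C * t n) * (Dq - K * t n) ≤ m * (Dq - K * t n) :=
            mul_le_mul_of_nonneg_right hcon.le (by linarith)
          have h3 : Dp - Dp / Dq * K * t n + (A + 3 + Dp / Dq * K) * t n ≤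
              (Dp / Dq + C * t n) * (Dq - K * t n) := by
            have e1 : Dp / Dq * Dq = Dp := by field_simp
            have e2 : C * t n * (Dq / 2) ≤ C * t n * (Dq - K * t n) :=
              mul_le_mul_of_nonneg_left h1 (by positivity)
            have e3 : C * t n * (Dq / 2) = (A + 3 + Dp / Dq * K) * t n := by
              linear_combination t n / 2 * hCD
            linarith
          have h4 : L - m * (Dq - K * t n) ≤ -2 * (n * t n) := by
            have := mul_le_mul_of_nonneg_left h3 (Nat.cast_nonneg (α := ℝ) n)
            rw [hL]
            linarith
          have := mul_le_mul_of_nonneg_left h4 htn.le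
          linarith
  have hsplit := upperTail_add_strictTail_neg (tpow q m) (logRatio q m) L
  rw [(hq.tpow m).2] at hsplit
  rw [one_mul] at hbig
  linarith [Real.exp_pos (-(2 * (n * t n ^ 2))), Real.exp_pos (-((n : ℝ) * t n ^ 2))]

/-- If all shifts below `Δ` lead to a valid comparison of tails, then `Δ` bounds the second-order
rate from below. -/
lemma le_liminf_rate (hd : d ≠ 0) (hp : IsProbDist p) (hq : IsProbDist q)
    (hDp : 0 < relD p (unif d)) (hDq : 0 < relD q (unif d)) (hVp : 0 < relV p (unif d))
    (ht : ModerateSeq t) {ε R : ℕ → ℝ} {Δ : ℝ} (hε : ∀ n, 0 ≤ ε n ∧ ε n ≤ 1)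
    (hε' : ∀ᶠ n : ℕ in atTop, ε n ≤ 1 - Real.exp (-(n * t n ^ 2)))
    (hR : ∀ n, R n = (↑(sSup {m : ℕ | ApproxMajTV (tensor (tpow p n) (tpow (unif d) m))
      (tensor (tpow q m) (tpow (unif d) n)) (ε n)}) : ℝ) / (n : ℝ))
    (htail : ∀ Δ' < Δ, ∀ k : ℕ → ℕ,
      Tendsto (fun n => (k n : ℝ) / n) atTop (𝓝 (relD p (unif d) / relD q (unif d))) →
      ∀ᶠ n : ℕ in atTop, ∀ z,
        upperTail (tpow q (k n)) (scaledLogRatio q t n (k n)) (z - Δ') ≤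
          upperTail (tpow p n) (scaledLogRatio p t n n) z
            + (ε n - 1 / 2 * Real.exp (-(n * t n ^ 2)))) :
    Δ / relD q (unif d) ≤
      liminf (fun n => (R n - relD p (unif d) / relD q (unif d)) / t n) atTop := by
  set Dp := relD p (unif d)
  set Dq := relD q (unif d)
  obtain ⟨C, hC0, hC⟩ := exists_rate_upper_bound hd hp hq hDp hDq hVp ht
  set S : ℕ → Set ℕ := fun n => {m : ℕ | ApproxMajTV (tensor (tpow p n) (tpow (unif d) m))
    (tensor (tpow q m) (tpow (unif d) n)) (ε n)} with hS
  have hbound : ∀ᶠ n : ℕ in atTop, ∀ m ∈ S n, (m : ℝ) ≤ n * (Dp / Dq + C * t n) := by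
    filter_upwards [hC, hε'] with n hn hεn m hm using hn m _ hεn hm
  have hup : ∀ᶠ n : ℕ in atTop, (R n - Dp / Dq) / t n ≤ C := by
    filter_upwards [hbound, ht.eventually_pos, eventually_gt_atTop 0] with n hn htn hn0
    have hn0' : (0 : ℝ) < n := by exact_mod_cast hn0
    rw [div_le_iff₀ htn, hR n, sub_le_iff_le_add, div_le_iff₀ hn0']
    change ((sSup (S n) : ℕ) : ℝ) ≤ _
    rcases (S n).eq_empty_or_nonempty with hS | hS
    · rw [hS, csSup_empty, bot_eq_zero, Nat.cast_zero]
      positivity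
    · have := hn _ (Nat.sSup_mem hS ⟨_, fun m hm => Nat.le_floor (hn m hm)⟩)
      linarith
  refine le_of_forall_lt_imp_le_of_dense fun c hc => ?_
  refine le_liminf_of_le (isBoundedUnder_of_eventually_le hup).isCoboundedUnder_ge ?_
  obtain ⟨Δ₁, hΔ₁, hΔ₁'⟩ := exists_between ((lt_div_iff₀ hDq).1 hc)
  obtain ⟨Δ₂, hΔ₂, hΔ₂'⟩ := exists_between hΔ₁'
  set x : ℕ → ℝ := fun n => (n * Dp + Δ₁ * (n * t n)) / Dq with hx
  have hxn : Tendsto (fun n => x n / n) atTop (𝓝 (Dp / Dq)) := by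
    have : Tendsto (fun n => (Dp + Δ₁ * t n) / Dq) atTop (𝓝 ((Dp + Δ₁ * 0) / Dq)) :=
      ((ht.1.const_mul Δ₁).const_add Dp).div_const Dq
    rw [mul_zero, add_zero] at this
    refine this.congr' ?_
    filter_upwards [eventually_gt_atTop 0] with n hn0
    have : (n : ℝ) ≠ 0 := by positivity
    simp only [hx]
    field_simp
  have hx0 : ∀ᶠ n in atTop, 0 ≤ x n := by
    filter_upwards [hxn.eventually_const_lt (show 0 < Dp / Dq by positivity),
      eventually_gt_atTop 0] with n hn hn0
    have hn0' : (0 : ℝ) < n := by exact_mod_cast hn0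
    exact ((div_pos_iff_of_pos_right hn0').1 hn).le
  set k : ℕ → ℕ := fun n => ⌊x n⌋₊ with hk
  have hkn : Tendsto (fun n => (k n : ℝ) / n) atTop (𝓝 (Dp / Dq)) := by
    have hlow : Tendsto (fun n : ℕ => x n / n - 1 / (n : ℝ)) atTop (𝓝 (Dp / Dq)) := by
      simpa using hxn.sub tendsto_one_div_atTop_nhds_zero_nat
    refine tendsto_of_tendsto_of_tendsto_of_le_of_le' hlow hxn ?_ ?_
    · filter_upwards with n
      rw [← sub_div]
      gcongr
      exact (Nat.sub_one_lt_floor (x n)).le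
    · filter_upwards [hx0] with n hn
      gcongr
      exact Nat.floor_le hn
  have hmem := eventually_approxMajTV (k := k) (Δ := Δ₂) (ρ := Δ₂ - Δ₁) hd hp hq ht
    (by linarith) hε (htail Δ₂ hΔ₂' k hkn) (by
      filter_upwards [hx0] with n hn
      have := Nat.floor_le hn
      simp only [hx] at this
      rw [le_div_iff₀ hDq] at this
      linarith)
  have hinv : Tendsto (fun n : ℕ => ((n : ℝ) * t n)⁻¹) atTop (𝓝 0) :=
    ht.tendsto_mul.inv_tendsto_atTop
  have hgap : 0 < Δ₁ / Dq - c := by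
    rw [sub_pos, lt_div_iff₀ hDq]
    exact hΔ₁
  filter_upwards [hmem, hbound, ht.eventually_pos, eventually_gt_atTop 0,
    hinv.eventually_lt_const hgap] with n hn hb htn hn0 hgapn
  have hn0' : (0 : ℝ) < n := by exact_mod_cast hn0
  have hle : k n ≤ sSup (S n) := le_csSup ⟨_, fun m hm => Nat.le_floor (hb m hm)⟩ hn
  have hle' : x n - 1 ≤ ((sSup (S n) : ℕ) : ℝ) :=
    (Nat.sub_one_lt_floor (x n)).le.trans (by exact_mod_cast hle)
  rw [le_div_iff₀ htn, hR n, le_sub_iff_add_le, le_div_iff₀ hn0']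
  refine le_trans ?_ hle'
  have h1 : (Δ₁ / Dq - c) * (n * t n) ≥ 1 := by
    rw [inv_lt_iff_one_lt_mul₀ (by positivity)] at hgapn
    linarith
  have h2 : x n = n * (Dp / Dq) + Δ₁ / Dq * (n * t n) := by
    simp only [hx]
    ring
  rw [h2]
  linarith

end Conversion

/-- Achieveability: lower bounds on the optimal thermodynamic-direction conversion rate
at infinite temperature, in both the direct and converse regimes. -/
theorem thermo_uniform_achieveability
    {d : ℕ} (hd : 2 ≤ d) (p q : Fin d → ℝ) (hp : IsProbDist p) (hq : IsProbDist q)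
    (hDp : 0 < relD p (unif d)) (hDq : 0 < relD q (unif d))
    (hVp : 0 < relV p (unif d)) (hVq : 0 < relV q (unif d))
    (t : ℕ → ℝ) (ht : ModerateSeq t)
    (R : ℕ → ℝ → ℝ)
    (hR : ∀ n : ℕ, ∀ e : ℝ, 0 ≤ e → R n e =
      (↑(sSup {m : ℕ | ApproxMajTV (tensor (tpow p n) (tpow (unif d) m))
          (tensor (tpow q m) (tpow (unif d) n)) e}) : ℝ) / (n : ℝ))
    (ν : ℝ)
    (hν : ν = (relV p (unif d) / relD p (unif d)) / (relV q (unif d) / relD q (unif d))) :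
    (-(Real.sqrt (2 * relV p (unif d)) / relD q (unif d)) * |1 - 1 / Real.sqrt ν| ≤
      Filter.liminf (fun n : ℕ =>
        (R n (Real.exp (-((n : ℝ) * t n ^ 2))) - relD p (unif d) / relD q (unif d)) / t n)
        atTop) ∧
    (Real.sqrt (2 * relV p (unif d)) / relD q (unif d) * |1 + 1 / Real.sqrt ν| ≤
      Filter.liminf (fun n : ℕ =>
        (R n (1 - Real.exp (-((n : ℝ) * t n ^ 2))) - relD p (unif d) / relD q (unif d)) / t n)
        atTop) := by
  have hd0 : d ≠ 0 := by omega
  set Vp := relV p (unif d) with hVp'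
  set Vq := relV q (unif d) with hVq'
  set Dp := relD p (unif d) with hDp'
  set Dq := relD q (unif d) with hDq'
  set v := √Vp with hv'
  set u := √(Dp / Dq * Vq) with hu'
  have hv : 0 < v := Real.sqrt_pos.2 hVp
  have hu : 0 < u := Real.sqrt_pos.2 (by positivity)
  have hratio : v * (1 / √ν) = u := by
    rw [hv', hu', hν, one_div, ← Real.sqrt_inv, ← Real.sqrt_mul hVp.le]
    congr 1
    field_simp
  have hsqrt : √(2 * Vp) = √2 * v := Real.sqrt_mul (by norm_num) _
  have hG₁ : GaussianScaling (fun n => tpow p n) (fun n => scaledLogRatio p t n n)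
      (fun n => n * t n ^ 2) (v ^ 2) := by
    have := gaussianScaling_tpow (k := fun n => n) (κ := 1) hp ht zero_le_one
      (tendsto_const_nhds.congr' (by
        filter_upwards [eventually_gt_atTop 0] with n hn
        have : (n : ℝ) ≠ 0 := by positivity
        field_simp))
    rwa [one_mul, ← hVp', ← Real.sq_sqrt hVp.le] at this
  have hG₂ : ∀ k : ℕ → ℕ, Tendsto (fun n => (k n : ℝ) / n) atTop (𝓝 (Dp / Dq)) →
      GaussianScaling (fun n => tpow q (k n)) (fun n => scaledLogRatio q t n (k n))
        (fun n => n * t n ^ 2) (u ^ 2) := by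
    intro k hk
    rw [hu', Real.sq_sqrt (by positivity)]
    exact gaussianScaling_tpow hq ht (by positivity) hk
  have hexp : ∀ n : ℕ, Real.exp (-((n : ℝ) * t n ^ 2)) ≤ 1 := fun n =>
    Real.exp_le_one_iff.2 (neg_nonpos.2 (by positivity))
  have hexp0 : ∀ n : ℕ, 0 < Real.exp (-((n : ℝ) * t n ^ 2)) := fun n => Real.exp_pos _
  constructor
  · have h := le_liminf_rate (ε := fun n => Real.exp (-((n : ℝ) * t n ^ 2)))
      (Δ := -(√2 * |v - u|)) hd0 hp hq hDp hDq hVp ht (fun n => ⟨(hexp0 n).le, hexp n⟩)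
      (by
        filter_upwards [eventually_exp_neg_mul_le ht.tendsto_mul_sq one_pos 2] with n hn
        rw [zero_mul, neg_zero, Real.exp_zero, one_mul] at hn
        linarith)
      (fun n => hR n _ (hexp0 n).le)
      (fun Δ' hΔ' k hk => by
        filter_upwards [hG₁.upperTail_le_of_direct (hG₂ k hk) hv hu (fun n => hp.tpow n)
          (fun n => hq.tpow (k n)) ht.tendsto_mul_sq (D := -Δ') (by linarith)] with n hn z
        have := hn z
        rw [← sub_eq_add_neg] at this
        linarith)
    refine le_trans (le_of_eq ?_) h
    have : |v - u| = v * |1 - 1 / √ν| := by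
      rw [← hratio, ← abs_of_pos hv, ← abs_mul, abs_of_pos hv]
      congr 1
      ring
    rw [this, hsqrt]
    ring
  · have h := le_liminf_rate (ε := fun n => 1 - Real.exp (-((n : ℝ) * t n ^ 2)))
      (Δ := √2 * (v + u)) hd0 hp hq hDp hDq hVp ht
      (fun n => ⟨by linarith [hexp n], by linarith [hexp0 n]⟩)
      (Eventually.of_forall fun n => le_rfl)
      (fun n => hR n _ (by linarith [hexp n]))
      (fun Δ' hΔ' k hk => by
        filter_upwards [hG₁.upperTail_le_of_converse (hG₂ k hk) hv hu (fun n => hp.tpow n)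
          (fun n => hq.tpow (k n)) ht.tendsto_mul_sq hΔ'] with n hn z
        linarith [hn z, hexp0 n])
    refine le_trans (le_of_eq ?_) h
    rw [abs_of_pos (by positivity), hsqrt, ← hratio]
    ring
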